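/- Let V be a continuous and concave capacity on a measurable space (Ω,𝓕), let v be its conjugate capacity, let θ : Ω → Ω be a measurable transformation preserving V that is ergodic with respect to V, and let ξ : Ω → ℝ be a bounded measurable random variable. Then there exists a constant c such that (1/n) ∑_{k=0}^{n−1} ξ(θ^k ω) converges to c as n → ∞ quasi-surely (i.e. V of the set where it does not converge to c is 0), and c lies in the interval [∫_Ω ξ dv, ∫_Ω ξ dV], where the integrals are Choquet integrals with respect to v and V respectively. -/

import Mathlib

open MeasureTheory Filter Topology Set

def IsFinAddProb {Ω : Type*} [MeasurableSpace Ω] (P : Set Ω → ℝ) : Prop :=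
  P ∅ = 0 ∧ P Set.univ = 1 ∧
    (∀ A : Set Ω, MeasurableSet A → 0 ≤ P A ∧ P A ≤ 1) ∧
    (∀ A B : Set Ω, MeasurableSet A → MeasurableSet B → Disjoint A B →
      P (A ∪ B) = P A + P B)

def IsCapacity {Ω : Type*} [MeasurableSpace Ω] (μ : Set Ω → ℝ) : Prop :=
  μ ∅ = 0 ∧ μ Set.univ = 1 ∧
    ∀ A B : Set Ω, MeasurableSet A → MeasurableSet B → A ⊆ B → μ A ≤ μ B

def ContBelow {Ω : Type*} [MeasurableSpace Ω] (μ : Set Ω → ℝ) : Prop :=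
  ∀ A : ℕ → Set Ω, (∀ n, MeasurableSet (A n)) → Monotone A →
    Filter.Tendsto (fun n => μ (A n)) Filter.atTop (nhds (μ (⋃ n, A n)))

def ContAbove {Ω : Type*} [MeasurableSpace Ω] (μ : Set Ω → ℝ) : Prop :=
  ∀ A : ℕ → Set Ω, (∀ n, MeasurableSet (A n)) → Antitone A →
    Filter.Tendsto (fun n => μ (A n)) Filter.atTop (nhds (μ (⋂ n, A n)))

def ContAtEmpty {Ω : Type*} [MeasurableSpace Ω] (μ : Set Ω → ℝ) : Prop :=
  ∀ A : ℕ → Set Ω, (∀ n, MeasurableSet (A n)) → Antitone A → (⋂ n, A n) = ∅ →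
    Filter.Tendsto (fun n => μ (A n)) Filter.atTop (nhds 0)

def ContAtUniv {Ω : Type*} [MeasurableSpace Ω] (μ : Set Ω → ℝ) : Prop :=
  ∀ A : ℕ → Set Ω, (∀ n, MeasurableSet (A n)) → Monotone A → (⋃ n, A n) = Set.univ →
    Filter.Tendsto (fun n => μ (A n)) Filter.atTop (nhds 1)

def conjCap {Ω : Type*} (μ : Set Ω → ℝ) (A : Set Ω) : ℝ := 1 - μ Aᶜ

noncomputable def choquet {Ω : Type*} (μ : Set Ω → ℝ) (ξ : Ω → ℝ) : ℝ :=
  (∫ t in Set.Ioi (0:ℝ), μ {ω | ξ ω ≥ t}) +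
    (∫ t in Set.Iio (0:ℝ), (μ {ω | ξ ω ≥ t} - 1))

noncomputable def choquetE {Ω : Type*} (μ : Set Ω → ℝ) (ξ : Ω → EReal) : ℝ :=
  (∫ t in Set.Ioi (0:ℝ), μ {ω | (t : EReal) ≤ ξ ω}) +
    (∫ t in Set.Iio (0:ℝ), (μ {ω | (t : EReal) ≤ ξ ω} - 1))

def UpperProbOf {Ω : Type*} [MeasurableSpace Ω] (𝒮 : Set (Set Ω → ℝ)) (V : Set Ω → ℝ) : Prop :=
  ∀ A : Set Ω, MeasurableSet A → V A = sSup ((fun P => P A) '' 𝒮)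

def LowerProbOf {Ω : Type*} [MeasurableSpace Ω] (𝒮 : Set (Set Ω → ℝ)) (v : Set Ω → ℝ) : Prop :=
  ∀ A : Set Ω, MeasurableSet A → v A = sInf ((fun P => P A) '' 𝒮)

def ErgodicCap {Ω : Type*} [MeasurableSpace Ω] (μ : Set Ω → ℝ) (θ : Ω → Ω) : Prop :=
  ∀ B : Set Ω, MeasurableSet B → θ ⁻¹' B = B →
    (μ B = 0 ∨ μ B = 1) ∧ (μ B = 0 ∨ μ Bᶜ = 0)

def PreservesCap {Ω : Type*} [MeasurableSpace Ω] (μ : Set Ω → ℝ) (θ : Ω → Ω) : Prop :=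
  ∀ A : Set Ω, MeasurableSet A → μ (θ ⁻¹' A) = μ A

def IndepSigmaWrt {Ω : Type*} (μ : Set Ω → ℝ) (m₁ m₂ : MeasurableSpace Ω) : Prop :=
  ∀ A B : Set Ω, MeasurableSet[m₁] A → MeasurableSet[m₂] B → μ (A ∩ B) = μ A * μ B


/-- A monotone submodular function on a bounded distributive lattice dominates a modular one. -/
theorem exists_modular_le {L : Type*} [DistribLattice L] [BoundedOrder L] (U : L → ℝ)
    (h0 : U ⊥ = 0) (h1 : U ⊤ = 1) (hm : Monotone U)
    (hs : ∀ a b, U (a ⊔ b) + U (a ⊓ b) ≤ U a + U b) :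
    ∃ m : L → ℝ, m ≤ U ∧ m ⊥ = 0 ∧ m ⊤ = 1 ∧ Monotone m ∧
      ∀ a b, m (a ⊔ b) + m (a ⊓ b) = m a + m b := by
  let S : Set (L → ℝ) := {f | f ⊥ = 0 ∧ f ⊤ = 1 ∧ Monotone f ∧
    ∀ a b, f (a ⊔ b) + f (a ⊓ b) ≤ f a + f b}
  have key := @zorn_le_nonempty₀ (L → ℝ)ᵒᵈ _ S ?_ U ⟨h0, h1, hm, hs⟩
  · obtain ⟨m, hmU, hmS, hmin⟩ := key
    change L → ℝ at m
    obtain ⟨m0, m1, mm, ms⟩ := id hmS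
    refine ⟨m, hmU, m0, m1, mm, fun a b => le_antisymm (ms a b) ?_⟩
    let g : L → ℝ := fun b => m (a ⊔ b) + m (a ⊓ b) - m a
    have hg : g ∈ S := by
      refine ⟨?_, ?_, ?_, ?_⟩
      · simp [g, m0]
      · simp [g, m1]
      · intro x y hxy
        have e1 := mm (sup_le_sup_left hxy a)
        have e2 := mm (inf_le_inf_left a hxy)
        simp only [g]; linarith
      · intro x y
        have e1 := ms (a ⊔ x) (a ⊔ y)
        have e2 := ms (a ⊓ x) (a ⊓ y)
        rw [← sup_sup_distrib_left, ← sup_inf_left] at e1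
        rw [← inf_sup_left, ← inf_inf_distrib_left] at e2
        simp only [g]; linarith
    have hgm : g ≤ m := fun x => by
      have := ms a x
      simp only [g]; linarith
    have h2 : m ≤ g := hmin hg hgm
    have := h2 b
    simp only [g] at this; linarith
  · intro c hcS hc y hy
    change Set (L → ℝ) at c
    have : Nonempty c := ⟨⟨y, hy⟩⟩
    have bdd : ∀ a, BddBelow (range fun f : c => f.1 a) := fun a => by
      refine ⟨0, ?_⟩
      rintro _ ⟨f, rfl⟩
      have := hcS f.2
      rw [← this.1]
      exact this.2.2.1 bot_le
    let W : L → ℝ := fun a => ⨅ f : c, f.1 a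
    have hW : ∀ f ∈ c, ∀ a, W a ≤ f a := fun f hf a => ciInf_le (bdd a) ⟨f, hf⟩
    refine ⟨W, ⟨?_, ?_, ?_, ?_⟩, fun f hf => hW f hf⟩
    · have : ∀ f : c, f.1 ⊥ = 0 := fun f => (hcS f.2).1
      simp [W, this]
    · have : ∀ f : c, f.1 ⊤ = 1 := fun f => (hcS f.2).2.1
      simp [W, this]
    · intro a b hab
      exact ciInf_mono (bdd a) (fun f => (hcS f.2).2.2.1 hab)
    · intro a b
      have main : ∀ f ∈ c, ∀ g ∈ c, W (a ⊔ b) + W (a ⊓ b) ≤ f a + g b := by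
        intro f hf g hg
        obtain ⟨h, hh, h1, h2⟩ : ∃ h ∈ c, (∀ x, h x ≤ f x) ∧ (∀ x, h x ≤ g x) := by
          rcases hc.total hf hg with h | h
          · exact ⟨g, hg, h, fun _ => le_rfl⟩
          · exact ⟨f, hf, fun _ => le_rfl, h⟩
        have := (hcS hh).2.2.2 a b
        linarith [hW h hh (a ⊔ b), hW h hh (a ⊓ b), h1 a, h2 b]
      have s1 : ∀ g ∈ c, W (a ⊔ b) + W (a ⊓ b) - g b ≤ W a := fun g hg =>
        le_ciInf fun f => by linarith [main f.1 f.2 g hg]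
      have s2 : W (a ⊔ b) + W (a ⊓ b) - W a ≤ W b :=
        le_ciInf fun g => by linarith [s1 g.1 g.2]
      linarith

/-- An invariant finitely additive probability dominated by `V`. -/
theorem exists_inv_finAdd {Ω : Type*} [MeasurableSpace Ω]
    (V : Set Ω → ℝ) (hcap : IsCapacity V)
    (hconc : ∀ A B : Set Ω, MeasurableSet A → MeasurableSet B →
      V (A ∪ B) + V (A ∩ B) ≤ V A + V B)
    (θ : Ω → Ω) (hθ : Measurable θ) (hpres : PreservesCap V θ) :
    ∃ Q : Set Ω → ℝ, IsFinAddProb Q ∧ (∀ A, MeasurableSet A → Q A ≤ V A) ∧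
      (∀ A, MeasurableSet A → Q (θ ⁻¹' A) = Q A) := by
  obtain ⟨m, hmV, m0, m1, mm, ms⟩ := exists_modular_le
    (fun A : Subtype (MeasurableSet : Set Ω → Prop) => V A) hcap.1 hcap.2.1
    (fun A B h => hcap.2.2 A B A.2 B.2 h) (fun A B => hconc A B A.2 B.2)
  classical
  let p : Set Ω → ℝ := fun A => if h : MeasurableSet A then m ⟨A, h⟩ else 0
  have pm : ∀ A (h : MeasurableSet A), p A = m ⟨A, h⟩ := fun A h => by simp [p, h]
  have p0 : p ∅ = 0 := by rw [pm ∅ .empty]; exact m0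
  have p1 : p univ = 1 := by rw [pm univ .univ]; exact m1
  have pnn : ∀ A, MeasurableSet A → 0 ≤ p A := fun A h => by
    rw [pm A h, ← m0]; exact mm bot_le
  have pV : ∀ A, MeasurableSet A → p A ≤ V A := fun A h => by rw [pm A h]; exact hmV _
  have V1 : ∀ A, MeasurableSet A → V A ≤ 1 := fun A h => by
    rw [← hcap.2.1]; exact hcap.2.2 _ _ h .univ (subset_univ _)
  have padd : ∀ A B, MeasurableSet A → MeasurableSet B → Disjoint A B →
      p (A ∪ B) = p A + p B := fun A B hA hB h => by
    have h1 := ms ⟨A, hA⟩ ⟨B, hB⟩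
    have h2 : (⟨A, hA⟩ ⊓ ⟨B, hB⟩ : Subtype (MeasurableSet : Set Ω → Prop)) = ⊥ :=
      Subtype.ext h.inter_eq
    rw [h2, m0, add_zero] at h1
    rw [pm A hA, pm B hB, pm _ (hA.union hB), ← h1]; rfl
  have mit : ∀ k A, MeasurableSet A → MeasurableSet (θ^[k] ⁻¹' A) :=
    fun k A h => (hθ.iterate k) h
  have pitV : ∀ k A, MeasurableSet A → p (θ^[k] ⁻¹' A) ≤ V A := by
    intro k A hA
    refine (pV _ (mit k A hA)).trans (le_of_eq ?_)
    induction k with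
    | zero => simp
    | succ k ih =>
      rw [Function.iterate_succ, preimage_comp, hpres _ (mit k A hA), ih]
  let q : ℕ → Set Ω → ℝ := fun n A => (∑ k ∈ Finset.range (n + 1), p (θ^[k] ⁻¹' A)) / (n + 1)
  have qnn : ∀ n A, MeasurableSet A → 0 ≤ q n A := fun n A h =>
    div_nonneg (Finset.sum_nonneg fun k _ => pnn _ (mit k A h)) (by positivity)
  have qV : ∀ n A, MeasurableSet A → q n A ≤ V A := fun n A h => by
    rw [div_le_iff₀ (by positivity)]
    refine (Finset.sum_le_card_nsmul _ _ (V A) fun k _ => pitV k A h).trans (le_of_eq ?_)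
    simp; ring
  let F : Ultrafilter ℕ := hyperfilter ℕ
  have hF : (F : Filter ℕ) ≤ atTop := by
    rw [← Nat.cofinite_eq_atTop]; exact hyperfilter_le_cofinite
  have hlim : ∀ A, MeasurableSet A → ∃ x, Tendsto (fun n => q n A) F (𝓝 x) := fun A h => by
    obtain ⟨x, -, hx⟩ := (isCompact_Icc (a := (0 : ℝ)) (b := 1)).ultrafilter_le_nhds
      (F.map fun n => q n A) (by
        rw [le_principal_iff]
        exact Filter.mem_map.2 (Filter.univ_mem'
          fun n => ⟨qnn n A h, (qV n A h).trans (V1 A h)⟩))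
    exact ⟨x, hx⟩
  let Q : Set Ω → ℝ := fun A => if h : MeasurableSet A then (hlim A h).choose else 0
  have hQ : ∀ A, MeasurableSet A → Tendsto (fun n => q n A) F (𝓝 (Q A)) := fun A h => by
    simp only [Q, h, dif_pos]; exact (hlim A h).choose_spec
  have QV : ∀ A, MeasurableSet A → Q A ≤ V A := fun A h =>
    le_of_tendsto (hQ A h) (Eventually.of_forall fun n => qV n A h)
  refine ⟨Q, ⟨?_, ?_, ?_, ?_⟩, QV, ?_⟩
  · refine tendsto_nhds_unique (hQ ∅ .empty) ?_
    simp [q, p0]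
  · refine tendsto_nhds_unique (hQ univ .univ) (Tendsto.congr (f₁ := fun _ => (1:ℝ)) ?_ tendsto_const_nhds)
    intro n
    have : (n:ℝ) + 1 ≠ 0 := by positivity
    simp [q, p1, this]
  · exact fun A h => ⟨ge_of_tendsto (hQ A h) (Eventually.of_forall fun n => qnn n A h),
      (QV A h).trans (V1 A h)⟩
  · intro A B hA hB hd
    refine tendsto_nhds_unique (hQ _ (hA.union hB)) (((hQ A hA).add (hQ B hB)).congr fun n => ?_)
    simp only [q]
    rw [← add_div, ← Finset.sum_add_distrib]
    congr 1
    refine Finset.sum_congr rfl fun k _ => ?_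
    rw [preimage_union, padd _ _ (mit k A hA) (mit k B hB) (hd.preimage _)]
  · intro A hA
    have hd : Tendsto (fun n : ℕ => q n (θ ⁻¹' A) - q n A) atTop (𝓝 0) := by
      refine squeeze_zero_norm (a := fun n : ℕ => 1 / ((n : ℝ) + 1)) (fun n => ?_)
        tendsto_one_div_add_atTop_nhds_zero_nat
      have e : q n (θ ⁻¹' A) - q n A = (p (θ^[n+1] ⁻¹' A) - p A) / (n + 1) := by
        simp only [q]
        rw [← sub_div]
        congr 1
        have : ∀ k, p (θ^[k] ⁻¹' (θ ⁻¹' A)) = p (θ^[k+1] ⁻¹' A) := fun k => by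
          rw [Function.iterate_succ', preimage_comp]
        simp only [this]
        rw [← Finset.sum_sub_distrib, Finset.sum_range_sub (fun k => p (θ^[k] ⁻¹' A))]
        simp
      rw [e, norm_div, Real.norm_eq_abs, Real.norm_eq_abs, abs_of_pos (by positivity : (0:ℝ) < n + 1)]
      gcongr
      have a1 := pnn _ (mit (n+1) A hA)
      have a2 := (pitV (n+1) A hA).trans (V1 A hA)
      have a3 := pnn A hA
      have a4 := (pV A hA).trans (V1 A hA)
      rw [abs_le]; constructor <;> linarith
    have := tendsto_nhds_unique (hd.mono_left hF) ((hQ _ (hθ hA)).sub (hQ A hA))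
    linarith

/-- An invariant probability measure dominated by `V`. -/
theorem exists_inv_measure {Ω : Type*} [MeasurableSpace Ω]
    (V : Set Ω → ℝ) (hcap : IsCapacity V) (ha : ContAbove V)
    (hconc : ∀ A B : Set Ω, MeasurableSet A → MeasurableSet B →
      V (A ∪ B) + V (A ∩ B) ≤ V A + V B)
    (θ : Ω → Ω) (hθ : Measurable θ) (hpres : PreservesCap V θ) :
    ∃ P : Measure Ω, IsProbabilityMeasure P ∧ (∀ A, MeasurableSet A → P.real A ≤ V A) ∧
      MeasurePreserving θ P P := by
  obtain ⟨Q, ⟨Q0, Q1, Qb, Qadd⟩, QV, Qinv⟩ := exists_inv_finAdd V hcap hconc θ hθ hpres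
  have Qsum : ∀ f : ℕ → Set Ω, (∀ i, MeasurableSet (f i)) → Pairwise (Function.onFun Disjoint f) →
      HasSum (fun i => Q (f i)) (Q (⋃ i, f i)) := by
    intro f hf hd
    rw [hasSum_iff_tendsto_nat_of_nonneg (fun i => (Qb _ (hf i)).1)]
    let T : ℕ → Set Ω := fun n => ⋃ i, ⋃ (_ : n ≤ i), f i
    have Tm : ∀ n, MeasurableSet (T n) := fun n =>
      MeasurableSet.iUnion fun i => MeasurableSet.iUnion fun _ => hf i
    have Tanti : Antitone T := fun a b hab => by
      intro x hx
      simp only [T, mem_iUnion] at hx ⊢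
      obtain ⟨i, hi, hx⟩ := hx
      exact ⟨i, hab.trans hi, hx⟩
    have Tempty : (⋂ n, T n) = ∅ := by
      rw [eq_empty_iff_forall_notMem]
      intro x hx
      rw [mem_iInter] at hx
      obtain ⟨i, hi⟩ := mem_iUnion.1 (hx 0)
      obtain ⟨_, hi⟩ := mem_iUnion.1 hi
      obtain ⟨j, hj⟩ := mem_iUnion.1 (hx (i+1))
      obtain ⟨hij, hj⟩ := mem_iUnion.1 hj
      exact disjoint_left.1 (hd (show i ≠ j by omega)) hi hj
    have Tsucc : ∀ n, Q (T n) = Q (f n) + Q (T (n+1)) := by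
      intro n
      rw [← Qadd _ _ (hf n) (Tm _)]
      · congr 1
        ext x
        simp only [T, mem_iUnion, mem_union]
        constructor
        · rintro ⟨i, hi, hx⟩
          rcases hi.eq_or_lt with rfl | h
          · exact Or.inl hx
          · exact Or.inr ⟨i, h, hx⟩
        · rintro (hx | ⟨i, hi, hx⟩)
          · exact ⟨n, le_rfl, hx⟩
          · exact ⟨i, by omega, hx⟩
      · rw [disjoint_left]
        intro x hx hx'
        simp only [T, mem_iUnion] at hx'
        obtain ⟨j, hj, hx'⟩ := hx'
        exact disjoint_left.1 (hd (show n ≠ j by omega)) hx hx'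
    have hs : ∀ n, Q (⋃ i, f i) - Q (T n) = ∑ i ∈ Finset.range n, Q (f i) := by
      intro n
      induction n with
      | zero => simp [T]
      | succ n ih => rw [Finset.sum_range_succ, ← ih, Tsucc n]; ring
    have hT : Tendsto (fun n => Q (T n)) atTop (𝓝 0) := by
      have := ha T Tm Tanti
      rw [Tempty, hcap.1] at this
      exact squeeze_zero (fun n => (Qb _ (Tm n)).1) (fun n => QV _ (Tm n)) this
    have := (tendsto_const_nhds (x := Q (⋃ i, f i))).sub hT
    rw [sub_zero] at this
    exact this.congr hs
  let P : Measure Ω := Measure.ofMeasurable (fun A _ => ENNReal.ofReal (Q A)) (by simp [Q0]) (by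
    intro f hf hd
    have h := Qsum f hf hd
    rw [← h.tsum_eq, ENNReal.ofReal_tsum_of_nonneg (fun i => (Qb _ (hf i)).1) h.summable])
  have hP : ∀ A, MeasurableSet A → P A = ENNReal.ofReal (Q A) := fun A h =>
    Measure.ofMeasurable_apply A h
  refine ⟨P, ⟨by rw [hP _ .univ, Q1]; simp⟩, fun A h => ?_, hθ, ?_⟩
  · rw [measureReal_def, hP A h, ENNReal.toReal_ofReal (Qb A h).1]; exact QV A h
  · ext A hA
    rw [Measure.map_apply hθ hA, hP _ (hθ hA), hP _ hA, Qinv A hA]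

/-- The running maximum of the Birkhoff sums `S_0, …, S_N`, defined recursively. -/
noncomputable def runMax {Ω : Type*} (θ : Ω → Ω) (g : Ω → ℝ) : ℕ → Ω → ℝ
  | 0 => fun _ => 0
  | N + 1 => fun ω => max 0 (g ω + runMax θ g N (θ ω))

theorem runMax_nonneg {Ω : Type*} (θ : Ω → Ω) (g : Ω → ℝ) (N : ℕ) (ω : Ω) :
    0 ≤ runMax θ g N ω := by
  cases N with
  | zero => exact le_rfl
  | succ N => exact le_max_left _ _

theorem runMax_le_succ {Ω : Type*} (θ : Ω → Ω) (g : Ω → ℝ) (N : ℕ) (ω : Ω) :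
    runMax θ g N ω ≤ runMax θ g (N + 1) ω := by
  induction N generalizing ω with
  | zero => exact runMax_nonneg θ g 1 ω
  | succ N ih => exact max_le_max le_rfl (by linarith [ih (θ ω)])

theorem birkhoffSum_le_runMax {Ω : Type*} (θ : Ω → Ω) (g : Ω → ℝ) (n : ℕ) (ω : Ω) :
    birkhoffSum θ g n ω ≤ runMax θ g n ω := by
  induction n generalizing ω with
  | zero => simp [runMax]
  | succ n ih =>
    rw [birkhoffSum_succ']
    exact le_max_of_le_right (by linarith [ih (θ ω)])

theorem runMax_le {Ω : Type*} (θ : Ω → Ω) (g : Ω → ℝ) (M : ℝ) (hM : ∀ ω, |g ω| ≤ M)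
    (N : ℕ) (ω : Ω) : runMax θ g N ω ≤ N * M := by
  induction N generalizing ω with
  | zero => simp [runMax]
  | succ N ih =>
    have h0 : 0 ≤ M := (abs_nonneg _).trans (hM ω)
    have := (abs_le.1 (hM ω)).2
    refine max_le (by positivity) ?_
    push_cast
    linarith [ih (θ ω)]

theorem measurable_runMax {Ω : Type*} [MeasurableSpace Ω] (θ : Ω → Ω) (hθ : Measurable θ)
    (g : Ω → ℝ) (hg : Measurable g) (N : ℕ) : Measurable (runMax θ g N) := by
  induction N with
  | zero => exact measurable_const
  | succ N ih => exact measurable_const.max (hg.add (ih.comp hθ))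

/-- A form of the maximal ergodic theorem. -/
theorem maximal_ergodic {Ω : Type*} [MeasurableSpace Ω] (P : Measure Ω) [IsProbabilityMeasure P]
    (θ : Ω → Ω) (hθ : MeasurePreserving θ P P) (g : Ω → ℝ) (hg : Measurable g)
    (hbd : ∃ M : ℝ, ∀ ω, |g ω| ≤ M) (hpos : ∀ᵐ ω ∂P, ∃ n, 0 < birkhoffSum θ g n ω) :
    0 ≤ ∫ ω, g ω ∂P := by
  obtain ⟨M, hM⟩ := hbd
  have gi : Integrable g P := Integrable.of_bound hg.aestronglyMeasurable M
    (Eventually.of_forall hM)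
  have hmeas := measurable_runMax θ hθ.measurable g hg
  let E : ℕ → Set Ω := fun N => {ω | 0 < runMax θ g N ω}
  have Em : ∀ N, MeasurableSet (E N) := fun N => measurableSet_lt measurable_const (hmeas N)
  have Emono : Monotone E := monotone_nat_of_le_succ fun N ω hω =>
    lt_of_lt_of_le hω (runMax_le_succ θ g N ω)
  have mi : ∀ N, Integrable (runMax θ g N) P := fun N =>
    Integrable.of_bound (hmeas N).aestronglyMeasurable (N * M) (Eventually.of_forall fun ω => by
      rw [Real.norm_eq_abs, abs_of_nonneg (runMax_nonneg θ g N ω)]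
      exact runMax_le θ g M hM N ω)
  have hE : ∀ N, 0 ≤ ∫ ω in E N, g ω ∂P := by
    intro N
    rw [← integral_indicator (Em N)]
    have h1 : ∫ ω, (runMax θ g N ω - runMax θ g N (θ ω)) ∂P = 0 := by
      have mi2 : Integrable (fun ω => runMax θ g N (θ ω)) P :=
        hθ.integrable_comp_of_integrable (mi N)
      rw [integral_sub (mi N) mi2]
      have : ∫ ω, runMax θ g N (θ ω) ∂P = ∫ ω, runMax θ g N ω ∂P := by
        conv_rhs => rw [← hθ.map_eq]
        rw [integral_map hθ.measurable.aemeasurable (hmeas N).aestronglyMeasurable]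
      rw [this, sub_self]
    rw [← h1]
    refine integral_mono ((mi N).sub (hθ.integrable_comp_of_integrable (mi N)))
      (gi.indicator (Em N)) fun ω => ?_
    change runMax θ g N ω - runMax θ g N (θ ω) ≤ _
    by_cases hω : ω ∈ E N
    · rw [indicator_of_mem hω]
      change 0 < runMax θ g N ω at hω
      cases N with
      | zero => exact absurd hω (lt_irrefl _)
      | succ N =>
        have e : runMax θ g (N+1) ω = g ω + runMax θ g N (θ ω) := by
          have : runMax θ g (N+1) ω = max 0 (g ω + runMax θ g N (θ ω)) := rfl
          rw [this] at hω ⊢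
          rcases lt_max_iff.1 hω with h | h
          · exact absurd h (lt_irrefl _)
          · exact max_eq_right h.le
        linarith [runMax_le_succ θ g N (θ ω)]
    · rw [indicator_of_notMem hω]
      have h1 : ¬ 0 < runMax θ g N ω := hω
      linarith [runMax_nonneg θ g N (θ ω)]
  have ht := tendsto_setIntegral_of_monotone (f := g) (μ := P) Em Emono gi.integrableOn
  have hge := ge_of_tendsto ht (Eventually.of_forall hE)
  rwa [setIntegral_eq_integral_of_ae_compl_eq_zero] at hge
  filter_upwards [hpos] with ω hω hn
  obtain ⟨n, hn'⟩ := hω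
  have hmem : ω ∈ E n := lt_of_lt_of_le hn' (birkhoffSum_le_runMax θ g n ω)
  exact absurd (mem_iUnion.2 ⟨n, hmem⟩) hn

theorem choquet_mono_cap {Ω : Type*} [MeasurableSpace Ω] (μ ν : Set Ω → ℝ)
    (hμ : IsCapacity μ) (hν : IsCapacity ν) (h : ∀ A, MeasurableSet A → μ A ≤ ν A)
    (ξ : Ω → ℝ) (hξ : Measurable ξ) (hbd : ∃ M : ℝ, ∀ ω, |ξ ω| ≤ M) :
    choquet μ ξ ≤ choquet ν ξ := by
  obtain ⟨M, hM⟩ := hbd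
  have meas : ∀ t : ℝ, MeasurableSet {ω | ξ ω ≥ t} := fun t => measurableSet_le measurable_const hξ
  have anti : ∀ κ : Set Ω → ℝ, IsCapacity κ → Antitone fun t : ℝ => κ {ω | ξ ω ≥ t} :=
    fun κ hκ s t hst => hκ.2.2 _ _ (meas t) (meas s) fun ω hω => le_trans hst hω
  have i1 : ∀ κ : Set Ω → ℝ, IsCapacity κ →
      IntegrableOn (fun t : ℝ => κ {ω | ξ ω ≥ t}) (Ioi 0) := by
    intro κ hκ
    have hi : IntegrableOn (fun t : ℝ => κ {ω | ξ ω ≥ t}) (Icc 0 (max 0 M)) :=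
      (anti κ hκ).antitoneOn _ |>.integrableOn_isCompact isCompact_Icc
    refine (hi.integrable_indicator measurableSet_Icc).integrableOn.congr_fun ?_ measurableSet_Ioi
    intro t ht
    by_cases h : t ∈ Icc 0 (max 0 M)
    · simp only [indicator_of_mem h]
    · simp only [indicator_of_notMem h]
      have : {ω | ξ ω ≥ t} = ∅ := by
        ext ω
        simp only [mem_ofPred_eq, mem_empty_iff_false, iff_false, not_le, ge_iff_le]
        by_contra hc
        push Not at hc
        exact h ⟨le_of_lt ht, le_max_of_le_right (hc.trans (abs_le.1 (hM ω)).2)⟩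
      rw [this, hκ.1]
  have i2 : ∀ κ : Set Ω → ℝ, IsCapacity κ →
      IntegrableOn (fun t : ℝ => κ {ω | ξ ω ≥ t} - 1) (Iio 0) := by
    intro κ hκ
    have an : Antitone fun t : ℝ => κ {ω | ξ ω ≥ t} - 1 :=
      fun s t hst => sub_le_sub_right (anti κ hκ hst) 1
    have hi : IntegrableOn (fun t : ℝ => κ {ω | ξ ω ≥ t} - 1) (Icc (min 0 (-M)) 0) :=
      an.antitoneOn _ |>.integrableOn_isCompact isCompact_Icc
    refine (hi.integrable_indicator measurableSet_Icc).integrableOn.congr_fun ?_ measurableSet_Iio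
    intro t ht
    by_cases h : t ∈ Icc (min 0 (-M)) 0
    · simp only [indicator_of_mem h]
    · simp only [indicator_of_notMem h]
      have : {ω | ξ ω ≥ t} = univ := by
        ext ω
        simp only [mem_ofPred_eq, mem_univ, iff_true, ge_iff_le]
        by_contra hc
        push Not at hc
        exact h ⟨min_le_of_right_le ((abs_le.1 (hM ω)).1.trans hc.le), le_of_lt ht⟩
      rw [this, hκ.2.1, sub_self]
  exact add_le_add (setIntegral_mono (i1 μ hμ) (i1 ν hν) fun t => h _ (meas t))
    (setIntegral_mono (i2 μ hμ) (i2 ν hν) fun t => sub_le_sub_right (h _ (meas t)) 1)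

theorem choquet_measure {Ω : Type*} [MeasurableSpace Ω] (P : Measure Ω) [IsProbabilityMeasure P]
    (ξ : Ω → ℝ) (hξ : Measurable ξ) (hi : Integrable ξ P) :
    choquet P.real ξ = ∫ ω, ξ ω ∂P := by
  have e1 : ∫ ω, max (ξ ω) 0 ∂P = ∫ t in Ioi (0:ℝ), P.real {ω | ξ ω ≥ t} := by
    rw [hi.pos_part.integral_eq_integral_meas_le (Eventually.of_forall fun ω => le_max_right _ _)]
    refine setIntegral_congr_fun measurableSet_Ioi fun t ht => ?_
    have ht : 0 < t := ht
    simp only [le_max_iff, not_le.2 ht, or_false, ge_iff_le]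
  have e2 : - ∫ ω, max (-ξ ω) 0 ∂P = ∫ t in Iio (0:ℝ), (P.real {ω | ξ ω ≥ t} - 1) := by
    rw [hi.neg_part.integral_eq_integral_meas_lt (Eventually.of_forall fun ω => le_max_right _ _)]
    rw [← integral_Iic_eq_integral_Iio]
    have := integral_comp_neg_Ioi 0 (fun t : ℝ => P.real {ω | ξ ω ≥ t} - 1)
    rw [neg_zero] at this
    rw [← this, ← integral_neg]
    refine setIntegral_congr_fun measurableSet_Ioi fun t ht => ?_
    have ht : 0 < t := ht
    have hc : {ω | t < max (-ξ ω) 0} = {ω | ξ ω ≥ -t}ᶜ := by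
      ext ω
      simp only [lt_max_iff, not_lt.2 ht.le, or_false, mem_ofPred_eq, mem_compl_iff, ge_iff_le,
        not_le]
      constructor <;> intro h <;> linarith
    rw [hc, probReal_compl_eq_one_sub (measurableSet_le measurable_const hξ)]
    ring
  rw [choquet, ← e1, ← e2, ← sub_eq_add_neg, ← integral_sub hi.pos_part hi.neg_part]
  refine integral_congr_ae (Eventually.of_forall fun ω => ?_)
  simp only
  rcases le_total 0 (ξ ω) with h | h
  · rw [max_eq_left h, max_eq_right (by linarith)]; ring
  · rw [max_eq_right h, max_eq_left (by linarith)]; ring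

/-- If `c = ∫ ξ dP` and `c < a`, then quasi-surely the Birkhoff averages are eventually `≤ a`. -/
theorem eventually_le_qs {Ω : Type*} [MeasurableSpace Ω]
    (V : Set Ω → ℝ) (θ : Ω → Ω) (herg : ErgodicCap V θ)
    (P : Measure Ω) [IsProbabilityMeasure P] (hPV : ∀ A, MeasurableSet A → P.real A ≤ V A)
    (hθ : MeasurePreserving θ P P)
    (ξ : Ω → ℝ) (hξ : Measurable ξ) (hbd : ∃ M : ℝ, ∀ ω, |ξ ω| ≤ M)
    (a : ℝ) (hc : ∫ ω, ξ ω ∂P < a) :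
    ∃ N : Set Ω, MeasurableSet N ∧ V N = 0 ∧
      ∀ ω, ω ∉ N → ∀ᶠ n in atTop, birkhoffAverage ℝ θ ξ n ω ≤ a := by
  have Am : ∀ n, Measurable (birkhoffAverage ℝ θ ξ n) := fun n => by
    have : Measurable fun ω => (n : ℝ)⁻¹ * ∑ k ∈ Finset.range n, ξ (θ^[k] ω) :=
      (Finset.measurable_sum _ fun k _ => hξ.comp (hθ.measurable.iterate k)).const_mul _
    exact this
  let E : Set Ω := ⋃ q : ℚ, ⋃ (_ : (q : ℝ) < a), ⋃ n₀ : ℕ, ⋂ n : ℕ, ⋂ (_ : n₀ ≤ n),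
    {ω | birkhoffAverage ℝ θ ξ n ω ≤ q}
  have memE : ∀ ω, ω ∈ E ↔ ∃ q : ℚ, (q : ℝ) < a ∧ ∀ᶠ n in atTop,
      birkhoffAverage ℝ θ ξ n ω ≤ q := by
    intro ω
    simp [E, eventually_atTop]
  have Em : MeasurableSet E :=
    .iUnion fun q => .iUnion fun _ => .iUnion fun n₀ => .iInter fun n => .iInter fun _ =>
      measurableSet_le (Am n) measurable_const
  have hbd' : Bornology.IsBounded (range ξ) := by
    obtain ⟨M, hM⟩ := hbd
    refine (isBounded_iff_forall_norm_le).2 ⟨M, ?_⟩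
    rintro _ ⟨ω, rfl⟩
    exact hM ω
  have hdiff := fun ω => tendsto_birkhoffAverage_apply_sub_birkhoffAverage' (𝕜 := ℝ) hbd' θ ω
  have Einv : θ ⁻¹' E = E := by
    ext ω
    rw [mem_preimage, memE, memE]
    constructor
    · rintro ⟨q, hq, h⟩
      obtain ⟨r, hqr, hra⟩ := exists_rat_btwn hq
      refine ⟨r, hra, ?_⟩
      have := (tendsto_order.1 (hdiff ω)).1 (q - r) (by linarith)
      filter_upwards [h, this] with n h1 h2
      linarith
    · rintro ⟨q, hq, h⟩
      obtain ⟨r, hqr, hra⟩ := exists_rat_btwn hq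
      refine ⟨r, hra, ?_⟩
      have := (tendsto_order.1 (hdiff ω)).2 (r - q) (by linarith)
      filter_upwards [h, this] with n h1 h2
      linarith
  rcases (herg E Em Einv).2 with h | h
  · exfalso
    have hP0 : P E = 0 := by
      have h1 := hPV E Em
      rw [h] at h1
      have h2 : P.real E = 0 := le_antisymm h1 measureReal_nonneg
      exact (measureReal_eq_zero_iff (measure_ne_top P E)).1 h2
    obtain ⟨b, hcb, hba⟩ := exists_rat_btwn hc
    have hi : Integrable ξ P := by
      obtain ⟨M, hM⟩ := hbd
      exact Integrable.of_bound hξ.aestronglyMeasurable M (Eventually.of_forall hM)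
    have := maximal_ergodic P θ hθ (fun ω => ξ ω - b) (hξ.sub measurable_const) ?_ ?_
    · rw [integral_sub hi (integrable_const _)] at this
      simp at this
      linarith
    · obtain ⟨M, hM⟩ := hbd
      refine ⟨M + |(b:ℝ)|, fun ω => (abs_sub _ _).trans ?_⟩
      linarith [hM ω]
    · have hae : ∀ᵐ ω ∂P, ω ∉ E := measure_eq_zero_iff_ae_notMem.1 hP0
      filter_upwards [hae] with ω hω
      rw [memE] at hω
      push Not at hω
      have hf := hω b hba
      obtain ⟨n, hn1, hn⟩ := (hf.and_eventually (eventually_ge_atTop 1)).exists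
      refine ⟨n, ?_⟩
      have hn0 : (0:ℝ) < n := by exact_mod_cast hn
      have e : birkhoffSum θ (fun ω => ξ ω - b) n ω = birkhoffSum θ ξ n ω - n * b := by
        simp [birkhoffSum]
      rw [e]
      simp only [birkhoffAverage, smul_eq_mul] at hn1
      rw [inv_mul_eq_div, lt_div_iff₀ hn0] at hn1
      linarith
  · refine ⟨Eᶜ, Em.compl, h, fun ω hω => ?_⟩
    obtain ⟨q, hq, hev⟩ := (memE ω).1 (not_not.1 hω)
    exact hev.mono fun n hn => hn.trans hq.le

theorem cap_nonneg {Ω : Type*} [MeasurableSpace Ω] (V : Set Ω → ℝ) (hcap : IsCapacity V)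
    (A : Set Ω) (hA : MeasurableSet A) : 0 ≤ V A := by
  rw [← hcap.1]; exact hcap.2.2 _ _ .empty hA (empty_subset _)

theorem cap_iUnion_null {Ω : Type*} [MeasurableSpace Ω]
    (V : Set Ω → ℝ) (hcap : IsCapacity V) (hb : ContBelow V)
    (hconc : ∀ A B : Set Ω, MeasurableSet A → MeasurableSet B →
      V (A ∪ B) + V (A ∩ B) ≤ V A + V B)
    (N : ℕ → Set Ω) (hN : ∀ n, MeasurableSet (N n)) (h0 : ∀ n, V (N n) = 0) :
    V (⋃ n, N n) = 0 := by
  have hm : ∀ n, MeasurableSet (accumulate N n) := fun n =>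
    .biUnion (to_countable _) fun i _ => hN i
  have hz : ∀ n, V (accumulate N n) = 0 := by
    intro n
    induction n with
    | zero => simpa using h0 0
    | succ n ih =>
      have := hconc _ _ (hm n) (hN (n+1))
      rw [ih, h0] at this
      have e : accumulate N (n+1) = accumulate N n ∪ N (n+1) := accumulate_succ N n
      have a1 := cap_nonneg V hcap _ ((hm n).inter (hN (n+1)))
      have a2 := cap_nonneg V hcap _ (hm (n+1))
      rw [e] at a2 ⊢
      linarith
  have := hb _ hm monotone_accumulate
  rw [iUnion_accumulate] at this
  simp only [hz] at this
  exact tendsto_nhds_unique this tendsto_const_nhds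

theorem stmt17 {Ω : Type*} [MeasurableSpace Ω]
    (V : Set Ω → ℝ) (hcap : IsCapacity V) (hb : ContBelow V) (ha : ContAbove V)
    (hconc : ∀ A B : Set Ω, MeasurableSet A → MeasurableSet B →
      V (A ∪ B) + V (A ∩ B) ≤ V A + V B)
    (θ : Ω → Ω) (hθ : Measurable θ) (hpres : PreservesCap V θ) (herg : ErgodicCap V θ)
    (ξ : Ω → ℝ) (hξ : Measurable ξ) (hbd : ∃ M : ℝ, ∀ ω, |ξ ω| ≤ M) :
    ∃ c : ℝ,
      V {ω | ¬ Filter.Tendsto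
        (fun n : ℕ => (1 / (n : ℝ)) * ∑ k ∈ Finset.range n, ξ (θ^[k] ω))
        Filter.atTop (nhds c)} = 0 ∧
      choquet (conjCap V) ξ ≤ c ∧ c ≤ choquet V ξ := by
  obtain ⟨P, hP, hPV, hθP⟩ := exists_inv_measure V hcap ha hconc θ hθ hpres
  have hi : Integrable ξ P := by
    obtain ⟨M, hM⟩ := hbd
    exact Integrable.of_bound hξ.aestronglyMeasurable M (Eventually.of_forall hM)
  have hcP : IsCapacity P.real := by
    refine ⟨by simp, by simp, fun A B _ _ h => measureReal_mono h⟩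
  have hcv : IsCapacity (conjCap V) := by
    refine ⟨by simp [conjCap, hcap.2.1], by simp [conjCap, hcap.1], fun A B hA hB h => ?_⟩
    have := hcap.2.2 _ _ hB.compl hA.compl (compl_subset_compl.2 h)
    simp only [conjCap]; linarith
  refine ⟨∫ ω, ξ ω ∂P, ?_, ?_, ?_⟩
  · set c := ∫ ω, ξ ω ∂P with hc
    have hbd' : ∃ M : ℝ, ∀ ω, |-ξ ω| ≤ M := by simpa only [abs_neg] using hbd
    have hpos : ∀ k : ℕ, (0:ℝ) < 1 / ((k:ℝ) + 1) := fun k => Nat.one_div_pos_of_nat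
    have H1 := fun k : ℕ => eventually_le_qs V θ herg P hPV hθP ξ hξ hbd (c + 1 / ((k:ℝ) + 1))
      (by linarith [hpos k])
    have H2 := fun k : ℕ => eventually_le_qs V θ herg P hPV hθP (fun ω => -ξ ω) hξ.neg hbd'
      (-c + 1 / ((k:ℝ) + 1)) (by rw [integral_neg]; linarith [hpos k])
    choose N1 N1m N1z N1e using H1
    choose N2 N2m N2z N2e using H2
    have z1 := cap_iUnion_null V hcap hb hconc N1 N1m N1z
    have z2 := cap_iUnion_null V hcap hb hconc N2 N2m N2z
    have m1 : MeasurableSet (⋃ k, N1 k) := .iUnion N1m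
    have m2 : MeasurableSet (⋃ k, N2 k) := .iUnion N2m
    have z : V ((⋃ k, N1 k) ∪ ⋃ k, N2 k) ≤ 0 := by
      have := hconc _ _ m1 m2
      have := cap_nonneg V hcap _ (m1.inter m2)
      linarith
    have Am : ∀ n : ℕ, Measurable fun ω => (1 / (n : ℝ)) * ∑ k ∈ Finset.range n, ξ (θ^[k] ω) :=
      fun n => (Finset.measurable_sum _ fun k _ => hξ.comp (hθ.iterate k)).const_mul _
    have mN : MeasurableSet {ω | ¬ Filter.Tendsto
        (fun n : ℕ => (1 / (n : ℝ)) * ∑ k ∈ Finset.range n, ξ (θ^[k] ω))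
        Filter.atTop (nhds c)} := (measurableSet_tendsto (𝓝 c) Am).compl
    refine le_antisymm (le_trans (hcap.2.2 _ _ mN (m1.union m2) ?_) z) (cap_nonneg V hcap _ mN)
    intro ω hω
    by_contra hn
    apply hω
    simp only [mem_union, mem_iUnion, not_or, not_exists] at hn
    have e1 : ∀ n : ℕ, (1 / (n : ℝ)) * ∑ k ∈ Finset.range n, ξ (θ^[k] ω) =
        birkhoffAverage ℝ θ ξ n ω := fun n => by simp [birkhoffAverage, birkhoffSum]
    have e2 : ∀ n : ℕ, birkhoffAverage ℝ θ (fun ω => -ξ ω) n ω =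
        - birkhoffAverage ℝ θ ξ n ω := fun n => by simp [birkhoffAverage, birkhoffSum]
    simp only [e1]
    refine tendsto_order.2 ⟨fun a ha' => ?_, fun a ha' => ?_⟩
    · obtain ⟨k, hk⟩ := exists_nat_one_div_lt (sub_pos.2 ha')
      filter_upwards [N2e k ω (hn.2 k)] with n hn'
      rw [e2] at hn'
      linarith
    · obtain ⟨k, hk⟩ := exists_nat_one_div_lt (sub_pos.2 ha')
      filter_upwards [N1e k ω (hn.1 k)] with n hn'
      linarith
  · rw [← choquet_measure P ξ hξ hi]
    refine choquet_mono_cap _ _ hcv hcP (fun A hA => ?_) ξ hξ hbd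
    have := hPV _ hA.compl
    rw [probReal_compl_eq_one_sub hA] at this
    simp only [conjCap]; linarith
  · rw [← choquet_measure P ξ hξ hi]
    exact choquet_mono_cap _ _ hcP hcap hPV ξ hξ hbd
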